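/- arXiv:2308.15751 — 3 statements merged into one kernel-verified Lean document; each statement's English description precedes it below -/
import Mathlib

section
/- For any two roots δ₁, δ₂ ∈ R with B(δ₁,δ₂) = 0 and δ₁ ≠ ±δ₂, the number of orbits of the subgroup generated by the two reflections r_{δ₁}, r_{δ₂} acting on the 72-element set R is exactly 36. (The 2A₁ row of Table 1: a cubic surface hyperplane section with two A₁ singularities has exactly 36 limiting primitive vanishing cycles.) -/
/-- The intersection form on the lattice `I^{1,6} ≅ H²(S,ℤ)` of a smooth cubic surface. -/
def B (x y : Fin 7 → ℤ) : ℤ := x 0 * y 0 - ∑ i : Fin 6, x i.succ * y i.succ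

/-- The hyperplane class `h = 3e₀ - e₁ - ⋯ - e₆`. -/
def h : Fin 7 → ℤ := fun j => if j = 0 then 3 else -1

/-- The root system `R = {α : B(α,α) = -2, B(α,h) = 0}` (primitive vanishing cycles). -/
def R : Set (Fin 7 → ℤ) := {α | B α α = -2 ∧ B α h = 0}

/-- The reflection `r_α(β) = β + B(β,α)·α` in a root `α`. -/
def reflect (α β : Fin 7 → ℤ) : Fin 7 → ℤ := β + B β α • α


/-- Integer 7-tuples, convenient for kernel computation. -/
abbrev Tup := ℤ × ℤ × ℤ × ℤ × ℤ × ℤ × ℤ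

set_option synthInstance.maxSize 1000 in
set_option synthInstance.maxHeartbeats 400000 in
instance instDecidableEqTup : DecidableEq Tup := inferInstance

/-- The form on tuples. -/
def dotT : Tup → Tup → ℤ
  | (a, b, c, d, e, f, g), (a₂, b₂, c₂, d₂, e₂, f₂, g₂) =>
    a * a₂ - (b * b₂ + (c * c₂ + (d * d₂ + (e * e₂ + (f * f₂ + g * g₂)))))

/-- Tuples as vectors. -/
def toV : Tup → (Fin 7 → ℤ)
  | (a, b, c, d, e, f, g) => ![a, b, c, d, e, f, g]

/-- Vectors as tuples. -/
def ofV (v : Fin 7 → ℤ) : Tup := (v 0, v 1, v 2, v 3, v 4, v 5, v 6)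

/-- Append the last coordinate, forced by orthogonality to `h`. -/
def extT : ℤ × ℤ × ℤ × ℤ × ℤ × ℤ → Tup
  | (a, b, c, d, e, f) => (a, b, c, d, e, f, -(3 * a + b + c + d + e + f))

/-- Candidate tuples. -/
def cand : List Tup :=
  let s : List ℤ := [-1, 0, 1]
  (([-2, -1, 0, 1, 2] : List ℤ) ×ˢ (s ×ˢ (s ×ˢ (s ×ˢ (s ×ˢ s))))).map extT

/-- The roots as a list of tuples. -/
def rootList : List Tup :=
  cand.filter fun x => decide (dotT x (3, -1, -1, -1, -1, -1, -1) = 0) && decide (dotT x x = -2)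

theorem toV_ofV (v : Fin 7 → ℤ) : toV (ofV v) = v := by
  funext i; fin_cases i <;> rfl

theorem ofV_toV (v : Tup) : ofV (toV v) = v := rfl

theorem B_eq (v w : Fin 7 → ℤ) : B v w = dotT (ofV v) (ofV w) := by
  simp [B, dotT, ofV, Fin.sum_univ_succ]

theorem ofV_h : ofV h = (3, -1, -1, -1, -1, -1, -1) := by
  simp [ofV, h]

theorem mem_cand (v : Fin 7 → ℤ) (hv : v ∈ R) : ofV v ∈ cand := by
  obtain ⟨h1, h2⟩ := hv
  rw [B_eq] at h1 h2
  rw [ofV_h] at h2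
  simp only [ofV, dotT] at h1 h2
  have key : (2 * v 1 + v 0) ^ 2 + (2 * v 2 + v 0) ^ 2 + (2 * v 3 + v 0) ^ 2
      + (2 * v 4 + v 0) ^ 2 + (2 * v 5 + v 0) ^ 2 + (2 * v 6 + v 0) ^ 2 = 8 - 2 * v 0 ^ 2 := by
    linear_combination (-4) * h1 + 4 * v 0 * h2
  have h0 : -2 ≤ v 0 ∧ v 0 ≤ 2 := by constructor <;> nlinarith
  have aux : ∀ t : ℤ, (2 * t + v 0) ^ 2 ≤ 8 - 2 * v 0 ^ 2 → t = -1 ∨ t = 0 ∨ t = 1 := by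
    intro t ht
    obtain ⟨ha, hb⟩ := h0
    have : -1 ≤ t ∧ t ≤ 1 := by
      generalize v 0 = x at *
      interval_cases x <;> constructor <;> nlinarith
    omega
  have hx0 : v 0 = -2 ∨ v 0 = -1 ∨ v 0 = 0 ∨ v 0 = 1 ∨ v 0 = 2 := by omega
  have auxm : ∀ t : ℤ, (2 * t + v 0) ^ 2 ≤ 8 - 2 * v 0 ^ 2 → t ∈ ([-1, 0, 1] : List ℤ) := by
    intro t ht
    simpa using aux t ht
  refine List.mem_map.2 ⟨(v 0, v 1, v 2, v 3, v 4, v 5), ?_, ?_⟩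
  · refine List.pair_mem_product.2 ⟨by simpa using hx0, List.pair_mem_product.2 ⟨auxm _ ?_,
      List.pair_mem_product.2 ⟨auxm _ ?_, List.pair_mem_product.2 ⟨auxm _ ?_,
      List.pair_mem_product.2 ⟨auxm _ ?_, auxm _ ?_⟩⟩⟩⟩⟩ <;>
    nlinarith
  · have h6 : -(3 * v 0 + v 1 + v 2 + v 3 + v 4 + v 5) = v 6 := by linarith
    simp only [extT, ofV, h6]

theorem mem_rootList (v : Fin 7 → ℤ) : ofV v ∈ rootList ↔ v ∈ R := by
  constructor
  · intro hv
    have := (List.mem_filter.1 hv).2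
    simp only [Bool.and_eq_true, decide_eq_true_eq] at this
    refine ⟨?_, ?_⟩
    · rw [B_eq]; exact this.2
    · rw [B_eq, ofV_h]; exact this.1
  · intro hv
    refine List.mem_filter.2 ⟨mem_cand v hv, ?_⟩
    obtain ⟨h1, h2⟩ := hv
    rw [B_eq] at h1 h2
    rw [ofV_h] at h2
    simp [h1, h2]

/-- Explicit list of roots. -/
def rootExpl : List Tup := [
  (-2, 1, 1, 1, 1, 1, 1), (-1, 0, 0, 0, 1, 1, 1), (-1, 0, 0, 1, 0, 1, 1),
  (-1, 0, 0, 1, 1, 0, 1), (-1, 0, 0, 1, 1, 1, 0), (-1, 0, 1, 0, 0, 1, 1),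
  (-1, 0, 1, 0, 1, 0, 1), (-1, 0, 1, 0, 1, 1, 0), (-1, 0, 1, 1, 0, 0, 1),
  (-1, 0, 1, 1, 0, 1, 0), (-1, 0, 1, 1, 1, 0, 0), (-1, 1, 0, 0, 0, 1, 1),
  (-1, 1, 0, 0, 1, 0, 1), (-1, 1, 0, 0, 1, 1, 0), (-1, 1, 0, 1, 0, 0, 1),
  (-1, 1, 0, 1, 0, 1, 0), (-1, 1, 0, 1, 1, 0, 0), (-1, 1, 1, 0, 0, 0, 1),
  (-1, 1, 1, 0, 0, 1, 0), (-1, 1, 1, 0, 1, 0, 0), (-1, 1, 1, 1, 0, 0, 0),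
  (0, -1, 0, 0, 0, 0, 1), (0, -1, 0, 0, 0, 1, 0), (0, -1, 0, 0, 1, 0, 0),
  (0, -1, 0, 1, 0, 0, 0), (0, -1, 1, 0, 0, 0, 0), (0, 0, -1, 0, 0, 0, 1),
  (0, 0, -1, 0, 0, 1, 0), (0, 0, -1, 0, 1, 0, 0), (0, 0, -1, 1, 0, 0, 0),
  (0, 0, 0, -1, 0, 0, 1), (0, 0, 0, -1, 0, 1, 0), (0, 0, 0, -1, 1, 0, 0),
  (0, 0, 0, 0, -1, 0, 1), (0, 0, 0, 0, -1, 1, 0), (0, 0, 0, 0, 0, -1, 1),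
  (0, 0, 0, 0, 0, 1, -1), (0, 0, 0, 0, 1, -1, 0), (0, 0, 0, 0, 1, 0, -1),
  (0, 0, 0, 1, -1, 0, 0), (0, 0, 0, 1, 0, -1, 0), (0, 0, 0, 1, 0, 0, -1),
  (0, 0, 1, -1, 0, 0, 0), (0, 0, 1, 0, -1, 0, 0), (0, 0, 1, 0, 0, -1, 0),
  (0, 0, 1, 0, 0, 0, -1), (0, 1, -1, 0, 0, 0, 0), (0, 1, 0, -1, 0, 0, 0),
  (0, 1, 0, 0, -1, 0, 0), (0, 1, 0, 0, 0, -1, 0), (0, 1, 0, 0, 0, 0, -1),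
  (1, -1, -1, -1, 0, 0, 0), (1, -1, -1, 0, -1, 0, 0), (1, -1, -1, 0, 0, -1, 0),
  (1, -1, -1, 0, 0, 0, -1), (1, -1, 0, -1, -1, 0, 0), (1, -1, 0, -1, 0, -1, 0),
  (1, -1, 0, -1, 0, 0, -1), (1, -1, 0, 0, -1, -1, 0), (1, -1, 0, 0, -1, 0, -1),
  (1, -1, 0, 0, 0, -1, -1), (1, 0, -1, -1, -1, 0, 0), (1, 0, -1, -1, 0, -1, 0),
  (1, 0, -1, -1, 0, 0, -1), (1, 0, -1, 0, -1, -1, 0), (1, 0, -1, 0, -1, 0, -1),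
  (1, 0, -1, 0, 0, -1, -1), (1, 0, 0, -1, -1, -1, 0), (1, 0, 0, -1, -1, 0, -1),
  (1, 0, 0, -1, 0, -1, -1), (1, 0, 0, 0, -1, -1, -1), (2, -1, -1, -1, -1, -1, -1)]

theorem rootList_eq : rootList = rootExpl := by decide +kernel

/-- A numerical code of a tuple, used to check that the list has no repetitions. -/
def codeT : Tup → ℕ
  | (a, b, c, d, e, f, g) => (a * 729 + b * 243 + c * 81 + d * 27 + e * 9 + f * 3 + g + 3000).toNat

theorem rootExpl_codes : rootExpl.map codeT = [
  1906, 2284, 2302, 2308, 2310, 2356, 2362, 2364, 2380, 2382, 2388, 2518,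
  2524, 2526, 2542, 2544, 2550, 2596, 2598, 2604, 2622, 2758, 2760, 2766,
  2784, 2838, 2920, 2922, 2928, 2946, 2974, 2976, 2982, 2992, 2994, 2998,
  3002, 3006, 3008, 3018, 3024, 3026, 3054, 3072, 3078, 3080, 3162, 3216,
  3234, 3240, 3242, 3378, 3396, 3402, 3404, 3450, 3456, 3458, 3474, 3476,
  3482, 3612, 3618, 3620, 3636, 3638, 3644, 3690, 3692, 3698, 3716, 4094] := by decide +kernel

theorem rootExpl_nodup : rootExpl.Nodup := by
  refine List.Nodup.of_map codeT ?_
  rw [rootExpl_codes]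
  decide +kernel

/-- Roots pairing nonnegatively with both `x` and `y`. -/
def chamber (x y : Tup) : List Tup :=
  (rootExpl.filter fun b => decide (0 ≤ dotT b x)).filter fun b => decide (0 ≤ dotT b y)

/-- Mask of a predicate along a list, with one base 128 digit per entry. -/
def enc (p : Tup → Bool) : List Tup → ℕ
  | [] => 0
  | b :: l => 128 * enc p l + (p b).toNat

theorem land_digit (m n : ℕ) (a b : Bool) :
    (128 * m + a.toNat) &&& (128 * n + b.toNat) = 128 * (m &&& n) + (a && b).toNat := by
  have key : ∀ (k : ℕ) (c : Bool), 128 * k + c.toNat = Nat.bit c (Nat.bit false (Nat.bit false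
      (Nat.bit false (Nat.bit false (Nat.bit false (Nat.bit false k)))))) := by
    intro k c
    simp only [Nat.bit_val, Bool.toNat_false]
    omega
  rw [key, key, key]
  simp only [Nat.land_bit, Bool.and_false]

/-- Casting out: the sum of base 128 digits is read off modulo 127. -/
theorem enc_land_mod (p q : Tup → Bool) (l : List Tup) :
    (enc p l &&& enc q l) % 127 = ((l.filter p).filter q).length % 127 := by
  induction l with
  | nil => simp [enc]
  | cons b l ih =>
    simp only [enc, land_digit]
    cases hp : p b <;> cases hq : q b <;> simp [hp, hq, -List.filter_filter] <;> omega

/-- Bit mask of the half space of `x`. -/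
def maskT (x : Tup) : ℕ := enc (fun b => decide (0 ≤ dotT b x)) rootExpl

/-- The roots with their half space masks. -/
def table : List (Tup × ℕ) := [
  ((-2, 1, 1, 1, 1, 1, 1),
    412395667136521810395362481490091231775324982178653831745926471571166462539171597465608830529247767830032966674291335022854259625578111083987121209344),
  ((-1, 0, 0, 0, 1, 1, 1),
    412395667136521810395362481490091231775324688610830985016772985386091863872043175478118000132994458576336811925372790619737947234911701870406904315904),
  ((-1, 0, 0, 1, 0, 1, 1),
    412395667136521810395362481490091231775287405497329450414280239881602656046012627873820358267509980746100755550723397940346051923735596168721278697472),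
  ((-1, 0, 0, 1, 1, 0, 1),
    412395667136521810395362481490091231770515166969133021295208815306999230488487217529922644884157059226825399988072122465225755835402862473868870680576),
  ((-1, 0, 0, 1, 1, 1, 0),
    412395667136521810395362481490091231159668635359990094054066469757760760051570965697778713361760807946882163964446143264241225130401435520862911463424),
  ((-1, 0, 1, 0, 0, 1, 1),
    412395667136521810395362481490091152971312589389695407187842165383299053181174976536023156400546316960908667861037250993445441498991275437765053906944),
  ((-1, 0, 1, 0, 1, 0, 1),
    412395667136521810395362481490081144861738705191975488311139321767403602535095285239001089701550784103642294057320932945335254018399120759348889927680),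
  ((-1, 0, 1, 0, 1, 1, 0),
    412395667136521810395362481488800106836281527883825872093175338932785920763231074830644168671959523745230518951222222578751804848563577669711260827648),
  ((-1, 0, 1, 1, 0, 0, 1),
    412395667136521810395362481324827239577762832440675004737208156330213148394841248520604910248295856025256813881103020668067300606853799525951586959488),
  ((-1, 0, 1, 1, 0, 1, 0),
    412395667136521810395362460336300230487369815717363974630499527869058703322304333272515920230992719563879862994396433385302888570793223556932070015104),
  ((-1, 0, 1, 1, 1, 0, 0),
    412395667136521810395359773804843066917063675133552129448476258092510565735813114071187819067072655475992126655613257218739615289250974888797503766656),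
  ((-1, 1, 0, 0, 0, 1, 1),
    412395667136521810395015897778326129917877680405494860067300268983982129493538931098906626946611870178114522742329571782514621112078905400043100962816),
  ((-1, 1, 0, 0, 1, 0, 1),
    412395667136521810350999766384158194022070355214445432384210509491091342334302733430346526671684761210777610037652167085537286871867354703095096426496),
  ((-1, 1, 0, 0, 1, 1, 0),
    412395667136521804716934947930662399358732730760118688948721294401070586878405707465121320677143976963113537857885458602973832921222744019759012003840),
  ((-1, 1, 0, 1, 0, 0, 1),
    412395667136521083556638185883200682451517094156061527576809094119888627088799725019524377146742369397652087942381265154340924442265286404927762989184),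
  ((-1, 1, 0, 1, 0, 1, 0),
    412395667136428775038652643808100918327915315304617957071352726553152571456115900519418113136483583647460497851151216526223828068020570239842044084352),
  ((-1, 1, 0, 1, 1, 0, 0),
    412395667124613284736503258195331110506887913576387189220983363241989357394519540610488031335066594450838349064010352044610950623807639695398069616768),
  ((-1, 1, 1, 0, 0, 0, 1),
    412395665612230526061381899760795709415380496931787109288099501751555736072240012827960477263238819244009580536463516119816998187949021125990739361920),
  ((-1, 1, 1, 0, 0, 1, 0),
    412395472027237415645848020140264369702430870597630221456655826220745324977102383412679019285959507971606069604645916578368810668432544527753200812160),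
  ((-1, 1, 1, 0, 1, 0, 0),
    412370693148119282457511428712252886444878991082094844356592153603089521530802644212658228770044865849051273546000323772454290380871404209990516359296),
  ((-1, 1, 1, 1, 0, 0, 0),
    409198996620998234350427725926783029478238415369008343246291486381027606506508883719299613666708473571305465728714299029265583133584358554420388053120),
  ((0, -1, 0, 0, 0, 0, 1),
    412395667136521810395362481324817073855316477206370198233870500424855790933681139260993188099432278954940752473383090820564920414728290851248089858049),
  ((0, -1, 0, 0, 0, 1, 0),
    412395667136521810395362460335009026128619751565766624800511771398456950855104621398105883934620693712049138550348212017744140656933206971690497605633),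
  ((0, -1, 0, 0, 1, 0, 0),
    412395667136521810395359773803541854443967488256038431623749047711242841432628717774601981407019753626218835189157510503173149761400120431881243082753),
  ((0, -1, 0, 1, 0, 0, 0),
    412395667136521810395359752485788072811042620224774515984657410192397393718514187075273205431822763483310763897926728717344041641108145157521511809153),
  ((0, -1, 1, 0, 0, 0, 0),
    412395667136521810395359752484486782774904234863818717813258774986897584064634908522692074082151867454513147860844369931389280232599755767786854432897),
  ((0, 0, -1, 0, 0, 0, 1),
    412395667136521083511928887065502542835967479996144206331187718592183018902573235612488364223902322083597733160791124337117403851582596445775119515649),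
  ((0, 0, -1, 0, 0, 1, 0),
    412395667136428769359878526536906983438181549632392281254397946732348585421376353640767745940118260953894839305398471222022993584963502786818273705985),
  ((0, 0, -1, 0, 1, 0, 0),
    412395667124613279013713009529969239716574584220471604383940041200145540282838485443592987660821705210904785400309966043850024353842243390528055951361),
  ((0, 0, -1, 1, 0, 0, 0),
    412395667124519522541069124906450247115166624593363213938724754990961263773300977683837298577602604966734688019461393731128757577219361548754380390529),
  ((0, 0, 0, -1, 0, 0, 1),
    412395665612230526016672600943087404087079604887078211833021732403198060355096168497785579611702728835371987411741765483883305944969553675009120026625),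
  ((0, 0, 0, -1, 0, 1, 0),
    412395472027237409967073902867779231685335181341606280585879242125645784724681751464891796298743867945332563913741612206254739198662427683383951769601),
  ((0, 0, 0, -1, 1, 0, 0),
    412370693148119276734721180045589804422402092472857504709130422517781060461700162388356098826261879668055479746635844265303388922543563011463170768897),
  ((0, 0, 0, 0, -1, 0, 1),
    412395665612229799222311020276875987232513187963892288849196406094231373276527643424477238244840217569406261490761494724433096804471591161833199763585),
  ((0, 0, 0, 0, -1, 1, 0),
    412395472027144380288791577592717874305568770606142116643342118206864697504464891586056677931445870526147444090119063555019474738052698377720619335809),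
  ((0, 0, 0, 0, 0, -1, 1),
    412395665612229799178294888882698043222359740046926513170332378410841711766528495507621944549254969070591107334615452554369148615161744800930246705281),
  ((0, 0, 0, 0, 0, 1, -1),
    412395472027144374610710627743763096995773989317557054069882547049598363640854546843287425090169526621474792789816790811774918006537045665815136845953),
  ((0, 0, 0, 0, 1, -1, 0),
    412370693136210756754286782626301475646529900897154298615129240940540419525614307582915378869998659860643441475443658150053304236752609793488405414017),
  ((0, 0, 0, 0, 1, 0, -1),
    412370693136210751120221964171524642346888567525535011720533697466663864809585747659889637357802314345678356996385183956202977157192200700460594643073),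
  ((0, 0, 0, 1, -1, 0, 0),
    409198996620904472154993571318847173221465972214900232117015577573402141339870448673356881306934679160570862608069410758992377052003484793202095947905),
  ((0, 0, 0, 1, 0, -1, 0),
    409198996609088981852841499174620201825360191374661189965551519916870078489170397149290136619973958113671309131243187331068650272928412573207980163201),
  ((0, 0, 0, 1, 0, 0, -1),
    409198996608996673334855936110993428000518864190763662112244179079897955299397991053570687803787549822514546881928287022313454456580940691371584405633),
  ((0, 0, 1, -1, 0, 0, 0),
    412370496514543603374016385631829211355398274806855087296907308384133131355744582830325370640774853363105603343256289320647606927498007131397323505793),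
  ((0, 0, 1, 0, -1, 0, 0),
    409198799987422555266932661528605572755870114176006205150011791892188850388559302340588180690529396966328947825699428009867571592048279068479831687297),
  ((0, 0, 1, 0, 0, -1, 0),
    409174021108304422078593383569126917818438209878939063992774227296056576087822499552714253268449320819941626953136344096481794116713088423020252381313),
  ((0, 0, 1, 0, 0, 0, -1),
    409173827523311311663059482958787530989638389513321530035342281457234473072924672610406700950605266607135776336135679491281460212085197810312666955905),
  ((0, 1, -1, 0, 0, 0, 0),
    412395667124519516817932292529323275708376183146971842457970516983588037135965130287025179705077614669464229926355341836768056278772472648391865680001),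
  ((0, 1, 0, -1, 0, 0, 0),
    412370496514543597650879553256003529984746218721420599068965921575894440816969650174104732750788751433309680592127869077669943890168595799395115483265),
  ((0, 1, 0, 0, -1, 0, 0),
    409198799987328793071151965847014680416734966494866132536966435407543446199955922633727605836523841482876458343938126430000512659070560226217046327425),
  ((0, 1, 0, 0, 0, -1, 0),
    409174021096395169536649857412065453442348360113384481576552602749732974819256996524917401644492117344243512794401110541258004236264505740012495585409),
  ((0, 1, 0, 0, 0, 0, -1),
    409173827511309744969065617262938554942459337300199253962110578341249823822518485823802657625195666553411175460648681276737358736365226781644676939905),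
  ((1, -1, -1, -1, 0, 0, 0),
    3221841149504070920576937008213074443804392231131579923054653657924030299671965057928994880168897561281456424587639915319838025780043464418076409857),
  ((1, -1, -1, 0, -1, 0, 0),
    3221841149410314447933031066940300209546130799762343043733221440065879826725087315345700413129148628924593588078000561558799777370260998969217777793),
  ((1, -1, -1, 0, 0, -1, 0),
    3221841137594824101764827528535384812831379134506331234655441364073337207465357264843529052388311095000758685354117015214888732390164861264506929281),
  ((1, -1, -1, 0, 0, 0, -1),
    3221841137502509949714446010131778910041786348436687206791630836159803642054099785389478746639211406910172820343763946032927039289927054455690248321),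
  ((1, -1, 0, -1, -1, 0, 0),
    3221644515928397559872121275397567315761519615180604492740921241129433813581020925310509278949205105710165396234166605450871267858767748554085646465),
  ((1, -1, 0, -1, 0, -1, 0),
    3196865636810264327516711921760984587323935832143473191082843763874859223765222867789582092958177805030194763664009603308064895947520613122496807041),
  ((1, -1, 0, -1, 0, 0, -1),
    3196672051817148277917992859206840509797141262367200747825249141398319206756004834370307643863836969321166773170802596655140150321518627781081055361),
  ((1, -1, 0, 0, -1, -1, 0),
    25169109688489426071407482833739701181103780987416050263689859365848751321868283902164540784912570711822085802134605704336517417630062988859818113),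
  ((1, -1, 0, 0, -1, 0, -1),
    24975524603070492551985785921597228325994229255730425783588139991940190293191401132747123197605079125588822204718249733794861917772730131256721537),
  ((1, -1, 0, 0, 0, -1, -1),
    196633669447002066008745130298035400590295129185262166333003190015283217705692492174729327603505139855384627024090512304992291149258258630328449),
  ((1, 0, -1, -1, -1, 0, 0),
    3221644515834629641647760641511039712844138439558121725846768751895132558535760488818435989951866521126051130550235905450529969260538559309310607489),
  ((1, 0, -1, -1, 0, -1, 0),
    3196865624901006151161783600719740519918734487653602671710599833710079370671486842498982561353542464141301455030302015193424813765206932922470252673),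
  ((1, 0, -1, -1, 0, 0, -1),
    3196672039815587217642361903807598047063622660341259060809534097280457056768494763904596665175981450610710152226955692360031468976085435691976114305),
  ((1, 0, -1, 0, -1, -1, 0),
    25169097686928365795776527434497238447587454403241928649260065090416876519508553675574327030043413627334822778521048922040749889669313240974246017),
  ((1, 0, -1, 0, -1, 0, -1),
    24975512693812316197057464880353160920790609046311498970700932120499770825245016029023518371766543344222508581891956252739669891865118669027688577),
  ((1, 0, -1, 0, 0, -1, -1),
    196633575679083841648111243770432483206808231206306793709669627576189598552390717819005025166210381457122847639696477926226750328039536710402177),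
  ((1, 0, 0, -1, -1, -1, 0),
    12001566693999323376509558838202942368332670454492669891937446222834770329134890840419051849798423744558842812639330716912338110242755723393),
  ((1, 0, 0, -1, -1, 0, -1),
    11909252541948941858105952935413347306682368307751668021794810920554238915447524808066566719383632821362217090416718747313381406946013233281),
  ((1, 0, 0, -1, 0, -1, -1),
    93762195780738319701037538698595623648382607120159888440983961069674959050275267179859795547989799072942871489783541731839206576114122881),
  ((1, 0, 0, 0, -1, -1, -1),
    5723136832378428263304440334192140255306770963919515473251190877236984318985053226014206684480764787007059806763747510879247300313217),
  ((2, -1, -1, -1, -1, -1, -1),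
    2311557660210465775481772240934386837968191485145984124711900562531701796372646105771357281874772345503873)]

theorem table_eq : (rootExpl.map fun x => (x, maskT x)) = table := by decide +kernel

theorem table_count : ∀ r ∈ table, ∀ s ∈ table, dotT r.1 s.1 = 0 →
    (r.2 &&& s.2) % 127 = 36 := by decide +kernel

theorem chamber_count (x : Tup) (hx : x ∈ rootExpl) (y : Tup) (hy : y ∈ rootExpl)
    (hxy : dotT x y = 0) : (chamber x y).length = 36 := by
  have mx : (x, maskT x) ∈ table := by
    rw [← table_eq]; exact List.mem_map.2 ⟨x, hx, rfl⟩
  have my : (y, maskT y) ∈ table := by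
    rw [← table_eq]; exact List.mem_map.2 ⟨y, hy, rfl⟩
  have hc := table_count _ mx _ my hxy
  have he := enc_land_mod (fun b => decide (0 ≤ dotT b x)) (fun b => decide (0 ≤ dotT b y)) rootExpl
  have hl : (chamber x y).length ≤ 72 :=
    (List.length_filter_le _ _).trans (List.length_filter_le _ _)
  have hm : (chamber x y).length % 127 = 36 := he.symm.trans hc
  omega

theorem B_add_left (x y z : Fin 7 → ℤ) : B (x + y) z = B x z + B y z := by
  simp only [B_eq, ofV, dotT, Pi.add_apply]; ring

theorem B_smul_left (n : ℤ) (y z : Fin 7 → ℤ) : B (n • y) z = n * B y z := by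
  simp only [B_eq, ofV, dotT, Pi.smul_apply, smul_eq_mul]; ring

theorem B_comm (x y : Fin 7 → ℤ) : B x y = B y x := by
  simp only [B_eq, ofV, dotT]; ring

theorem B_reflect (a x z : Fin 7 → ℤ) : B (reflect a x) z = B x z + B x a * B a z := by
  rw [reflect, B_add_left, B_smul_left]

theorem reflect_mem (a x : Fin 7 → ℤ) (ha : a ∈ R) (hx : x ∈ R) : reflect a x ∈ R := by
  obtain ⟨h1, h2⟩ := ha
  obtain ⟨h3, h4⟩ := hx
  refine ⟨?_, ?_⟩
  · rw [B_reflect, B_comm x (reflect a x), B_comm a (reflect a x), B_reflect, B_reflect, h1, h3,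
      B_comm a x]
    ring
  · rw [B_reflect, h2, h4]; ring

/-- Twice the representative of the orbit of `x` in the closed chamber. -/
def normF (a b x : Fin 7 → ℤ) : Fin 7 → ℤ :=
  (2 : ℤ) • x + (B x a - |B x a|) • a + (B x b - |B x b|) • b

theorem normF_left (a b x : Fin 7 → ℤ) (ha : a ∈ R) (hab : B a b = 0) :
    normF a b (reflect a x) = normF a b x := by
  have e1 : B (reflect a x) a = - B x a := by rw [B_reflect, ha.1]; ring
  have e2 : B (reflect a x) b = B x b := by rw [B_reflect, hab]; ring
  rw [normF, normF, e1, e2, abs_neg, reflect]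
  module

theorem normF_symm (a b x : Fin 7 → ℤ) : normF a b x = normF b a x := by
  rw [normF, normF]; abel

theorem chamber_ncard (a b : Fin 7 → ℤ) (ha : a ∈ R) (hb : b ∈ R) (hab : B a b = 0) :
    {x | x ∈ R ∧ 0 ≤ B x a ∧ 0 ≤ B x b}.ncard = 36 := by
  have hc := chamber_count (ofV a) (by rw [← rootList_eq]; exact (mem_rootList a).2 ha)
    (ofV b) (by rw [← rootList_eq]; exact (mem_rootList b).2 hb) (by rw [← B_eq]; exact hab)
  have hnd : (chamber (ofV a) (ofV b)).Nodup := (rootExpl_nodup.filter _).filter _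
  have himg : {x | x ∈ R ∧ 0 ≤ B x a ∧ 0 ≤ B x b}
      = toV '' ((chamber (ofV a) (ofV b)).toFinset : Set Tup) := by
    ext x
    simp only [Set.mem_ofPred_eq, Set.mem_image, List.coe_toFinset, chamber, List.mem_filter,
      decide_eq_true_eq]
    constructor
    · rintro ⟨h1, h2, h3⟩
      refine ⟨ofV x, ⟨⟨?_, ?_⟩, ?_⟩, toV_ofV x⟩
      · rw [← rootList_eq]; exact (mem_rootList x).2 h1
      · rw [← B_eq]; exact h2
      · rw [← B_eq]; exact h3
    · rintro ⟨t, ⟨⟨h1, h2⟩, h3⟩, rfl⟩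
      have hh1 : ofV (toV t) ∈ rootList := by rw [ofV_toV, rootList_eq]; exact h1
      refine ⟨(mem_rootList _).1 hh1, ?_, ?_⟩
      · rw [B_eq]; exact h2
      · rw [B_eq]; exact h3
  rw [himg, Set.ncard_image_of_injective _ (Function.LeftInverse.injective ofV_toV),
    Set.ncard_coe_finset, List.toFinset_card_of_nodup hnd, hc]

/-- For two orthogonal roots `δ₁ ≠ ±δ₂` (type `2A₁`), the subgroup generated by the two
reflections `r_{δ₁}, r_{δ₂}` has exactly 36 orbits on the 72-element root system. -/
theorem orbits_2A1 (δ₁ δ₂ : Fin 7 → ℤ) (h₁ : δ₁ ∈ R) (h₂ : δ₂ ∈ R)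
    (horth : B δ₁ δ₂ = 0) (hne : δ₁ ≠ δ₂) (hne' : δ₁ ≠ -δ₂)
    (g₁ g₂ : Equiv.Perm (Fin 7 → ℤ))
    (hg₁ : ∀ β, g₁ β = reflect δ₁ β) (hg₂ : ∀ β, g₂ β = reflect δ₂ β) :
    {O : Set (Fin 7 → ℤ) | ∃ β ∈ R,
      O = MulAction.orbit (Subgroup.closure {g₁, g₂} : Subgroup (Equiv.Perm (Fin 7 → ℤ))) β}.ncard
      = 36 := by
  classical
  have horth' : B δ₂ δ₁ = 0 := by rw [B_comm]; exact horth
  set G : Subgroup (Equiv.Perm (Fin 7 → ℤ)) := Subgroup.closure {g₁, g₂} with hG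
  have m₁ : g₁ ∈ G := Subgroup.subset_closure (by simp)
  have m₂ : g₂ ∈ G := Subgroup.subset_closure (by simp)
  have inv : ∀ g ∈ G, ∀ x, normF δ₁ δ₂ (g x) = normF δ₁ δ₂ x := by
    intro g hg
    induction hg using Subgroup.closure_induction with
    | mem g hg =>
      intro x
      rcases hg with rfl | rfl
      · rw [hg₁, normF_left _ _ _ h₁ horth]
      · rw [hg₂, normF_symm, normF_left _ _ _ h₂ horth', normF_symm]
    | one => intro x; rfl
    | mul g g' _ _ ih ih' => intro x; rw [Equiv.Perm.mul_apply, ih, ih']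
    | inv g _ ih => intro x; rw [← ih (g⁻¹ x)]; simp
  have orb₁ : ∀ x, MulAction.orbit G (reflect δ₁ x) = MulAction.orbit G x := by
    intro x
    rw [← hg₁]
    exact MulAction.orbit_eq_iff.2 ⟨⟨g₁, m₁⟩, rfl⟩
  have orb₂ : ∀ x, MulAction.orbit G (reflect δ₂ x) = MulAction.orbit G x := by
    intro x
    rw [← hg₂]
    exact MulAction.orbit_eq_iff.2 ⟨⟨g₂, m₂⟩, rfl⟩
  rw [← chamber_ncard δ₁ δ₂ h₁ h₂ horth]
  symm
  rw [← Set.InjOn.ncard_image (f := fun x => MulAction.orbit G x)]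
  · congr 1
    ext O
    constructor
    · rintro ⟨x, hx, rfl⟩
      exact ⟨x, hx.1, rfl⟩
    · rintro ⟨x, hx, rfl⟩
      have step₁ : ∃ y ∈ R, 0 ≤ B y δ₁ ∧ MulAction.orbit G y = MulAction.orbit G x := by
        rcases le_total 0 (B x δ₁) with hs | hs
        · exact ⟨x, hx, hs, rfl⟩
        · refine ⟨reflect δ₁ x, reflect_mem _ _ h₁ hx, ?_, orb₁ x⟩
          rw [B_reflect, h₁.1]; linarith
      obtain ⟨y, hy, hy1, hyo⟩ := step₁
      rcases le_total 0 (B y δ₂) with hs | hs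
      · exact ⟨y, ⟨hy, hy1, hs⟩, hyo⟩
      · refine ⟨reflect δ₂ y, ⟨reflect_mem _ _ h₂ hy, ?_, ?_⟩, (orb₂ y).trans hyo⟩
        · rw [B_reflect, horth']; linarith
        · rw [B_reflect, h₂.1]; linarith
  · rintro x ⟨-, hx1, hx2⟩ y ⟨-, hy1, hy2⟩ hxy
    obtain ⟨g, hg⟩ := MulAction.orbit_eq_iff.1 hxy
    have e := inv g.1 g.2 y
    have hg' : g.1 y = x := hg
    rw [hg'] at e
    simp only [normF, abs_of_nonneg hx1, abs_of_nonneg hx2, abs_of_nonneg hy1,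
      abs_of_nonneg hy2, sub_self, zero_smul, add_zero] at e
    funext i
    have := congrFun e i
    simp only [Pi.smul_apply, smul_eq_mul] at this
    omega
end

section
/- For any three roots δ₁, δ₂, δ₃ ∈ R with B(δ₁,δ₂) = 1, B(δ₂,δ₃) = 1 and B(δ₁,δ₃) = 0 (a chain of type A₃), the number of orbits of the subgroup generated by the reflections r_{δ₁}, r_{δ₂}, r_{δ₃} acting on the 72-element set R is exactly 17. (The A₃ row of Table 1: a cubic surface hyperplane section with one A₃ singularity has exactly 17 limiting primitive vanishing cycles.) -/
namespace A3

abbrev V := Fin 7 → ℤ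

theorem B_eq (x y : V) : B x y = x 0 * y 0 - (x 1 * y 1 + x 2 * y 2 + x 3 * y 3 + x 4 * y 4
    + x 5 * y 5 + x 6 * y 6) := by
  simp only [B, Fin.sum_univ_six]
  rfl

theorem B_add_left (x y z : V) : B (x + y) z = B x z + B y z := by
  simp only [B_eq, Pi.add_apply]; ring

theorem B_smul_left (c : ℤ) (x z : V) : B (c • x) z = c * B x z := by
  simp only [B_eq, Pi.smul_apply, smul_eq_mul]; ring

theorem B_comm (x y : V) : B x y = B y x := by
  simp only [B_eq]; ring

theorem B_add_right (x y z : V) : B z (x + y) = B z x + B z y := by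
  rw [B_comm, B_add_left, B_comm x, B_comm y]

theorem B_smul_right (c : ℤ) (x z : V) : B z (c • x) = c * B z x := by
  rw [B_comm, B_smul_left, B_comm x]

theorem B_sub_left (x y z : V) : B (x - y) z = B x z - B y z := by
  simp only [B_eq, Pi.sub_apply]; ring

theorem B_sub_right (x y z : V) : B z (x - y) = B z x - B z y := by
  simp only [B_eq, Pi.sub_apply]; ring

/-- Four times the projection onto the orthogonal complement of the chain. -/
def proj (d₁ d₂ d₃ x : V) : V :=
  (4 : ℤ) • x + (3 * B x d₁ + 2 * B x d₂ + B x d₃) • d₁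
    + (2 * B x d₁ + 4 * B x d₂ + 2 * B x d₃) • d₂
    + (B x d₁ + 2 * B x d₂ + 3 * B x d₃) • d₃

/-- One reflection step. -/
def Step (d₁ d₂ d₃ x y : V) : Prop :=
  y = reflect d₁ x ∨ y = reflect d₂ x ∨ y = reflect d₃ x

/-- A transversal of 17 roots separated by `proj`. -/
def Q (d₁ d₂ d₃ : V) : Prop :=
  ∃ b : Fin 17 → V, (∀ i, b i ∈ R) ∧
    (∀ x ∈ R, ∃ i, Relation.ReflTransGen (Step d₁ d₂ d₃) x (b i)) ∧
    (∀ i j, proj d₁ d₂ d₃ (b i) = proj d₁ d₂ d₃ (b j) → i = j)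

theorem reflect_invol {c : V} (hc : c ∈ R) (x : V) : reflect c (reflect c x) = x := by
  have h1 : B c c = -2 := hc.1
  simp only [reflect, B_add_left, B_smul_left, h1]
  ext i
  simp only [Pi.add_apply, Pi.smul_apply, smul_eq_mul]
  ring

theorem B_reflect {c : V} (hc : c ∈ R) (x y : V) : B (reflect c x) (reflect c y) = B x y := by
  have h1 : B c c = -2 := hc.1
  simp only [reflect, B_add_left, B_smul_left, B_add_right, B_smul_right, h1, B_comm c]
  ring

theorem reflect_reflect {c : V} (hc : c ∈ R) (d x : V) :
    reflect c (reflect d x) = reflect (reflect c d) (reflect c x) := by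
  conv_rhs => rw [reflect, B_reflect hc]
  simp only [reflect, B_add_left, B_smul_left]
  ext i
  simp only [Pi.add_apply, Pi.smul_apply, smul_eq_mul]
  ring

theorem reflect_mem {c x : V} (hc : c ∈ R) (hx : x ∈ R) : reflect c x ∈ R := by
  refine ⟨by rw [B_reflect hc]; exact hx.1, ?_⟩
  rw [reflect, B_add_left, B_smul_left, hx.2, hc.2]; simp

theorem proj_reflect {c : V} (hc : c ∈ R) (d₁ d₂ d₃ x : V) :
    proj (reflect c d₁) (reflect c d₂) (reflect c d₃) (reflect c x)
      = reflect c (proj d₁ d₂ d₃ x) := by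
  simp only [proj, B_reflect hc]
  simp only [reflect, B_add_left, B_smul_left]
  ext i
  simp only [Pi.add_apply, Pi.smul_apply, smul_eq_mul]
  ring

theorem Q_of_reflect {c : V} (hc : c ∈ R) {d₁ d₂ d₃ : V}
    (hQ : Q (reflect c d₁) (reflect c d₂) (reflect c d₃)) : Q d₁ d₂ d₃ := by
  obtain ⟨b, hb, hr, hi⟩ := hQ
  refine ⟨fun i => reflect c (b i), fun i => reflect_mem hc (hb i), ?_, ?_⟩
  · intro x hx
    obtain ⟨i, h⟩ := hr _ (reflect_mem hc hx)
    refine ⟨i, ?_⟩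
    have := Relation.ReflTransGen.lift (p := Step d₁ d₂ d₃) (reflect c) ?_ _ _ h
    · simpa only [Function.onFun, reflect_invol hc] using this
    · rintro a b (rfl | rfl | rfl)
      · left; rw [reflect_reflect hc, reflect_invol hc]
      · right; left; rw [reflect_reflect hc, reflect_invol hc]
      · right; right; rw [reflect_reflect hc, reflect_invol hc]
  · intro i j h
    apply hi
    have e := proj_reflect hc (reflect c d₁) (reflect c d₂) (reflect c d₃)
    simp only [reflect_invol hc] at e
    rw [e, e] at h
    have := congrArg (reflect c) h
    simpa only [reflect_invol hc] using this

theorem sub_mem {x y : V} (hx : x ∈ R) (hy : y ∈ R) (hxy : B x y = -1) : x - y ∈ R := by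
  refine ⟨?_, ?_⟩
  · rw [B_sub_left, B_sub_right, B_sub_right, B_comm y x, hx.1, hy.1, hxy]; norm_num
  · rw [B_sub_left, hx.2, hy.2]; norm_num

theorem reflect_sub {x y : V} (hx : x ∈ R) (hxy : B x y = -1) : reflect (x - y) x = y := by
  rw [reflect, B_sub_right, hx.1, hxy]
  ext i
  simp

theorem reflect_fix {x y z : V} (h : B z x = B z y) : reflect (x - y) z = z := by
  rw [reflect, B_sub_right, h]
  simp

/-! Computable versions -/

def bb (x y : V) : ℤ := x 0 * y 0 - (x 1 * y 1 + x 2 * y 2 + x 3 * y 3 + x 4 * y 4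
    + x 5 * y 5 + x 6 * y 6)

def eqb (x y : V) : Bool := x 0 == y 0 && x 1 == y 1 && x 2 == y 2 && x 3 == y 3 && x 4 == y 4
    && x 5 == y 5 && x 6 == y 6

theorem eqb_iff (x y : V) : eqb x y = true ↔ x = y := by
  constructor
  · intro h
    simp only [eqb, Bool.and_eq_true, beq_iff_eq] at h
    ext i
    fin_cases i <;> simp <;> tauto
  · rintro rfl; simp [eqb]

def pos : List V :=
  [![0, 0, 0, 0, 0, 1, -1],
   ![0, 0, 0, 0, 1, -1, 0],
   ![0, 0, 0, 0, 1, 0, -1],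
   ![0, 0, 0, 1, -1, 0, 0],
   ![0, 0, 0, 1, 0, -1, 0],
   ![0, 0, 0, 1, 0, 0, -1],
   ![0, 0, 1, -1, 0, 0, 0],
   ![0, 0, 1, 0, -1, 0, 0],
   ![0, 0, 1, 0, 0, -1, 0],
   ![0, 0, 1, 0, 0, 0, -1],
   ![0, 1, -1, 0, 0, 0, 0],
   ![0, 1, 0, -1, 0, 0, 0],
   ![0, 1, 0, 0, -1, 0, 0],
   ![0, 1, 0, 0, 0, -1, 0],
   ![0, 1, 0, 0, 0, 0, -1],
   ![1, -1, -1, -1, 0, 0, 0],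
   ![1, -1, -1, 0, -1, 0, 0],
   ![1, -1, -1, 0, 0, -1, 0],
   ![1, -1, -1, 0, 0, 0, -1],
   ![1, -1, 0, -1, -1, 0, 0],
   ![1, -1, 0, -1, 0, -1, 0],
   ![1, -1, 0, -1, 0, 0, -1],
   ![1, -1, 0, 0, -1, -1, 0],
   ![1, -1, 0, 0, -1, 0, -1],
   ![1, -1, 0, 0, 0, -1, -1],
   ![1, 0, -1, -1, -1, 0, 0],
   ![1, 0, -1, -1, 0, -1, 0],
   ![1, 0, -1, -1, 0, 0, -1],
   ![1, 0, -1, 0, -1, -1, 0],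
   ![1, 0, -1, 0, -1, 0, -1],
   ![1, 0, -1, 0, 0, -1, -1],
   ![1, 0, 0, -1, -1, -1, 0],
   ![1, 0, 0, -1, -1, 0, -1],
   ![1, 0, 0, -1, 0, -1, -1],
   ![1, 0, 0, 0, -1, -1, -1],
   ![2, -1, -1, -1, -1, -1, -1]]

def reps : List V :=
  [![-2, 1, 1, 1, 1, 1, 1],
   ![-1, 0, 0, 0, 1, 1, 1],
   ![-1, 0, 1, 0, 1, 0, 1],
   ![-1, 0, 1, 0, 1, 1, 0],
   ![-1, 0, 1, 1, 1, 0, 0],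
   ![0, -1, 0, 0, 0, 0, 1],
   ![0, -1, 0, 0, 0, 1, 0],
   ![0, 0, -1, 1, 0, 0, 0],
   ![0, 0, 0, 0, 0, -1, 1],
   ![0, 0, 0, 0, 0, 1, -1],
   ![0, 0, 0, 0, 1, -1, 0],
   ![0, 0, 0, 0, 1, 0, -1],
   ![1, -1, -1, -1, 0, 0, 0],
   ![1, -1, 0, -1, 0, -1, 0],
   ![1, -1, 0, -1, 0, 0, -1],
   ![1, -1, 0, 0, 0, -1, -1],
   ![2, -1, -1, -1, -1, -1, -1]]

def neg (x : V) : V := ![-x 0, -x 1, -x 2, -x 3, -x 4, -x 5, -x 6]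

def roots : List V := pos ++ pos.map neg

def s₁ : V := ![0, 1, -1, 0, 0, 0, 0]
def s₂ : V := ![0, 0, 1, -1, 0, 0, 0]
def s₃ : V := ![0, 0, 0, 1, -1, 0, 0]

def tri : List ℤ := [-1, 0, 1]

theorem enum_check : ([-2, -1, 0, 1, 2] : List ℤ).all (fun a => tri.all fun b => tri.all fun c =>
    tri.all fun d => tri.all fun e => tri.all fun f => tri.all fun g =>
      !(3 * a + (b + c + d + e + f + g) == 0) ||
      !(a * a - (b * b + c * c + d * d + e * e + f * f + g * g) == -2) ||
      roots.any (eqb ![a, b, c, d, e, f, g])) = true := by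
  decide +kernel

theorem tri_mem {b : ℤ} (h₁ : -1 ≤ b) (h₂ : b ≤ 1) : b ∈ tri := by
  simp only [tri, List.mem_cons, List.not_mem_nil]; omega

theorem mem_roots {x : V} (hx : x ∈ R) : x ∈ roots := by
  obtain ⟨h1, h2⟩ := hx
  have h2' : 3 * x 0 + (x 1 + x 2 + x 3 + x 4 + x 5 + x 6) = 0 := by
    have : B x h = 3 * x 0 + (x 1 + x 2 + x 3 + x 4 + x 5 + x 6) := by
      rw [B_eq]; simp [h]; ring
    rw [← this, h2]
  rw [B_eq] at h1
  have hx : x = ![x 0, x 1, x 2, x 3, x 4, x 5, x 6] := by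
    ext i; fin_cases i <;> rfl
  generalize x 0 = a at *
  generalize x 1 = b at *
  generalize x 2 = c at *
  generalize x 3 = d at *
  generalize x 4 = e at *
  generalize x 5 = f at *
  generalize x 6 = g at *
  have ha : a * a ≤ 4 := by
    have h3 : a * (3 * a + (b + c + d + e + f + g)) = 0 := by rw [h2', mul_zero]
    nlinarith [sq_nonneg (2 * b + a), sq_nonneg (2 * c + a), sq_nonneg (2 * d + a),
      sq_nonneg (2 * e + a), sq_nonneg (2 * f + a), sq_nonneg (2 * g + a)]
  have ha1 : -2 ≤ a := by nlinarith
  have ha2 : a ≤ 2 := by nlinarith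
  have key : ∀ t : ℤ, 0 ≤ t * (t + 1) := fun t => by
    rcases le_or_gt 0 t with h | h <;> nlinarith
  have key' : ∀ t : ℤ, 0 ≤ t * (t - 1) := fun t => by
    rcases le_or_gt t 0 with h | h <;> nlinarith
  have bd : ∀ t : ℤ, t * (t + 1) ≤ 2 → t * (t - 1) ≤ 6 → -2 ≤ t ∧ t ≤ 1 := fun t h _ => by
    constructor <;> nlinarith
  have main : (∀ t ∈ [b, c, d, e, f, g], -1 ≤ t ∧ t ≤ 1) := by
    have bound : ∀ t : ℤ, (t * t ≤ 2 ∨ t * (t + 1) ≤ 0 ∨ t * (t - 1) ≤ 0) → -1 ≤ t ∧ t ≤ 1 := by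
      rintro t (h | h | h) <;> constructor <;> nlinarith
    intro t ht
    apply bound
    simp only [List.mem_cons, List.not_mem_nil, or_false] at ht
    have hc : a = 0 ∨ (a = 1 ∨ a = 2) ∨ (a = -1 ∨ a = -2) := by omega
    rcases hc with h0 | h0 | h0
    · left
      subst h0
      have k : ∀ t : ℤ, 0 ≤ t * t := fun t => mul_self_nonneg t
      have := k b; have := k c; have := k d; have := k e; have := k f; have := k g
      rcases ht with rfl | rfl | rfl | rfl | rfl | rfl <;> linarith
    · right; left
      have := key b; have := key c; have := key d; have := key e; have := key f; have := key g
      rcases h0 with rfl | rfl <;>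
      rcases ht with rfl | rfl | rfl | rfl | rfl | rfl <;> linarith
    · right; right
      have := key' b; have := key' c; have := key' d; have := key' e; have := key' f
      have := key' g
      rcases h0 with rfl | rfl <;>
      rcases ht with rfl | rfl | rfl | rfl | rfl | rfl <;> linarith
  have C := enum_check
  simp only [List.all_eq_true] at C
  have m : ∀ t ∈ [b, c, d, e, f, g], t ∈ tri := fun t ht => tri_mem (main t ht).1 (main t ht).2
  have C' := C a (by simp only [List.mem_cons, List.not_mem_nil]; omega) b (m b (by simp))
    c (m c (by simp)) d (m d (by simp)) e (m e (by simp)) f (m f (by simp)) g (m g (by simp))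
  rw [hx]
  simp only [Bool.or_eq_true, Bool.not_eq_true', beq_eq_false_iff_ne, List.any_eq_true,
    eqb_iff] at C'
  rcases C' with (C' | C') | ⟨y, hy, e⟩
  · exact absurd h2' C'
  · exact absurd h1 C'
  · rw [e]; exact hy

theorem roots_check : roots.all (fun x => bb x x == -2 && bb x ![3, -1, -1, -1, -1, -1, -1] == 0)
    = true := by
  decide +kernel

theorem of_mem_roots {x : V} (hx : x ∈ roots) : x ∈ R := by
  have := List.all_eq_true.1 roots_check x hx
  simp only [Bool.and_eq_true, beq_iff_eq] at this
  refine ⟨by rw [B_eq]; exact this.1, ?_⟩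
  have e : h = ![3, -1, -1, -1, -1, -1, -1] := by decide
  rw [e, B_eq]; exact this.2

/-- Equal or at an angle of 60 degrees. -/
def adj (x y : V) : Bool := eqb x y || bb x y == -1

def conn (l : List V) (t : V) : Bool :=
  l.all fun x => l.any fun y => adj x y && l.any fun z => adj y z && adj z t

def l₂ : List V := roots.filter fun x => bb x s₂ == 1
def l₃ : List V := roots.filter fun x => bb x s₂ == 1 && bb x s₁ == 0

theorem conn₁ : conn roots s₂ = true := by decide +kernel
theorem conn₂ : conn l₂ s₁ = true := by decide +kernel
theorem conn₃ : conn l₃ s₃ = true := by decide +kernel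

theorem conn_induct {l : List V} {t : V} (hc : conn l t = true) (ht : t ∈ l) (P : V → Prop)
    (hP : ∀ x ∈ l, ∀ y ∈ l, B x y = -1 → P y → P x) (h0 : P t) : ∀ x ∈ l, P x := by
  have hP' : ∀ x ∈ l, ∀ y ∈ l, adj x y = true → P y → P x := by
    intro x hx y hy h hy'
    simp only [adj, Bool.or_eq_true, eqb_iff, beq_iff_eq] at h
    rcases h with rfl | h
    · exact hy'
    · exact hP x hx y hy (by rw [B_eq]; exact h) hy'
  intro x hx
  simp only [conn, List.all_eq_true, List.any_eq_true, Bool.and_eq_true] at hc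
  obtain ⟨y, hy, h1, z, hz, h2, h3⟩ := hc x hx
  exact hP' x hx y hy h1 (hP' y hy z hz h2 (hP' z hz t ht h3 h0))

/-! The standard chain -/

def reflb (d x : V) (y : V) : Bool :=
  y 0 == x 0 + bb x d * d 0 && y 1 == x 1 + bb x d * d 1 && y 2 == x 2 + bb x d * d 2
  && y 3 == x 3 + bb x d * d 3 && y 4 == x 4 + bb x d * d 4 && y 5 == x 5 + bb x d * d 5
  && y 6 == x 6 + bb x d * d 6

theorem reflb_iff {d x y : V} (h : reflb d x y = true) : y = reflect d x := by
  simp only [reflb, Bool.and_eq_true, beq_iff_eq] at h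
  have e : bb x d = B x d := by rw [B_eq]; rfl
  rw [e] at h
  ext i
  fin_cases i <;> simp [reflect] <;> tauto

def stepb (x y : V) : Bool := eqb x y || reflb s₁ x y || reflb s₂ x y || reflb s₃ x y

theorem stepb_reach {x y : V} (h : stepb x y = true) :
    Relation.ReflTransGen (Step s₁ s₂ s₃) x y := by
  simp only [stepb, Bool.or_eq_true, eqb_iff] at h
  rcases h with ((h | h) | h) | h
  · rw [h]
  · exact .single (Or.inl (reflb_iff h))
  · exact .single (Or.inr (Or.inl (reflb_iff h)))
  · exact .single (Or.inr (Or.inr (reflb_iff h)))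

theorem reach_check : (roots.all fun x => roots.any fun y => stepb x y &&
    roots.any fun z => stepb y z && reps.any fun w => stepb z w) = true := by
  decide +kernel

theorem reps_check : (reps.all fun x => roots.any (eqb x)) = true := by
  decide +kernel

def projb (x : V) : V := fun i => 4 * x i + (3 * bb x s₁ + 2 * bb x s₂ + bb x s₃) * s₁ i
    + (2 * bb x s₁ + 4 * bb x s₂ + 2 * bb x s₃) * s₂ i
    + (bb x s₁ + 2 * bb x s₂ + 3 * bb x s₃) * s₃ i

theorem projb_eq (x : V) : projb x = proj s₁ s₂ s₃ x := by
  have e : ∀ x y, bb x y = B x y := fun x y => by rw [B_eq]; rfl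
  ext i
  simp [projb, proj, e]

theorem reps_inj : ∀ i j : Fin 17, eqb (projb (reps.get i)) (projb (reps.get j)) = true → i = j := by
  decide +kernel

theorem Q_std : Q s₁ s₂ s₃ := by
  refine ⟨fun i => reps.get i, ?_, ?_, ?_⟩
  · intro i
    have := List.all_eq_true.1 reps_check _ (List.get_mem reps i)
    obtain ⟨y, hy, e⟩ := List.any_eq_true.1 this
    rw [eqb_iff] at e
    apply of_mem_roots
    change reps.get i ∈ roots
    rw [e]; exact hy
  · intro x hx
    have C := reach_check
    simp only [List.all_eq_true, List.any_eq_true, Bool.and_eq_true] at C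
    obtain ⟨y, hy, h1, z, hz, h2, w, hw, h3⟩ := C x (mem_roots hx)
    obtain ⟨i, hi⟩ := List.get_of_mem hw
    refine ⟨i, ?_⟩
    have := ((stepb_reach h1).trans (stepb_reach h2)).trans (stepb_reach h3)
    rw [← hi] at this
    exact this
  · intro i j h
    apply reps_inj
    rw [eqb_iff, projb_eq, projb_eq]
    exact h

theorem mem_l₂ {x : V} : x ∈ l₂ ↔ x ∈ R ∧ B x s₂ = 1 := by
  simp only [l₂, List.mem_filter, beq_iff_eq, B_eq, bb]
  exact and_congr_left fun _ => ⟨of_mem_roots, mem_roots⟩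

theorem mem_l₃ {x : V} : x ∈ l₃ ↔ x ∈ R ∧ B x s₂ = 1 ∧ B x s₁ = 0 := by
  simp only [l₃, List.mem_filter, beq_iff_eq, B_eq, bb, Bool.and_eq_true]
  exact and_congr_left fun _ => ⟨of_mem_roots, mem_roots⟩

theorem s₁_mem : s₁ ∈ R := ⟨by decide, by decide⟩
theorem s₂_mem : s₂ ∈ R := ⟨by decide, by decide⟩
theorem s₃_mem : s₃ ∈ R := ⟨by decide, by decide⟩

theorem Q₃ : ∀ x ∈ l₃, Q s₁ s₂ x := by
  refine conn_induct conn₃ (mem_l₃.2 ⟨s₃_mem, by decide, by decide⟩) _ ?_ Q_std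
  intro x hx y hy hxy hQ
  obtain ⟨hx, hx2, hx1⟩ := mem_l₃.1 hx
  obtain ⟨hy, hy2, hy1⟩ := mem_l₃.1 hy
  apply Q_of_reflect (sub_mem hx hy hxy)
  rw [reflect_sub hx hxy, reflect_fix (by rw [B_comm _ x, B_comm _ y, hx1, hy1]),
    reflect_fix (by rw [B_comm _ x, B_comm _ y, hx2, hy2])]
  exact hQ

theorem Q₂ : ∀ x ∈ l₂, ∀ z ∈ R, B x z = 0 → B s₂ z = 1 → Q x s₂ z := by
  refine conn_induct conn₂ (mem_l₂.2 ⟨s₁_mem, by decide⟩) _ ?_ ?_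
  · intro x hx y hy hxy hQ z hz hxz h2z
    obtain ⟨hx, hx2⟩ := mem_l₂.1 hx
    obtain ⟨hy, hy2⟩ := mem_l₂.1 hy
    have hc := sub_mem hx hy hxy
    have e1 := reflect_sub hx hxy
    have e2 : reflect (x - y) s₂ = s₂ := reflect_fix (by rw [B_comm _ x, B_comm _ y, hx2, hy2])
    apply Q_of_reflect hc
    rw [e1, e2]
    refine hQ _ (reflect_mem hc hz) ?_ ?_
    · have := B_reflect hc x z
      rw [e1] at this
      rw [this, hxz]
    · have := B_reflect hc s₂ z
      rw [e2] at this
      rw [this, h2z]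
  · intro z hz h1 h2
    exact Q₃ z (mem_l₃.2 ⟨hz, by rw [B_comm, h2], by rw [B_comm, h1]⟩)

theorem Q₁ : ∀ x ∈ roots, ∀ y ∈ R, ∀ z ∈ R, B y x = 1 → B x z = 1 → B y z = 0 → Q y x z := by
  refine conn_induct conn₁ (mem_roots s₂_mem) _ ?_ ?_
  · intro x hx y hy hxy hQ u hu z hz hux hxz huz
    replace hx := of_mem_roots hx
    replace hy := of_mem_roots hy
    have hc := sub_mem hx hy hxy
    have e1 := reflect_sub hx hxy
    apply Q_of_reflect hc
    rw [e1]
    refine hQ _ (reflect_mem hc hu) _ (reflect_mem hc hz) ?_ ?_ ?_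
    · have := B_reflect hc u x
      rw [e1] at this
      rw [this, hux]
    · have := B_reflect hc x z
      rw [e1] at this
      rw [this, hxz]
    · rw [B_reflect hc, huz]
  · intro y hy z hz h1 h2 h3
    exact Q₂ y (mem_l₂.2 ⟨hy, h1⟩) z hz h3 h2

theorem proj_step {d₁ d₂ d₃ : V} (h₁ : d₁ ∈ R) (h₂ : d₂ ∈ R) (h₃ : d₃ ∈ R)
    (h12 : B d₁ d₂ = 1) (h23 : B d₂ d₃ = 1) (h13 : B d₁ d₃ = 0) (x : V) :
    proj d₁ d₂ d₃ (reflect d₁ x) = proj d₁ d₂ d₃ x ∧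
    proj d₁ d₂ d₃ (reflect d₂ x) = proj d₁ d₂ d₃ x ∧
    proj d₁ d₂ d₃ (reflect d₃ x) = proj d₁ d₂ d₃ x := by
  have h21 : B d₂ d₁ = 1 := by rw [B_comm, h12]
  have h32 : B d₃ d₂ = 1 := by rw [B_comm, h23]
  have h31 : B d₃ d₁ = 0 := by rw [B_comm, h13]
  refine ⟨?_, ?_, ?_⟩ <;>
  · simp only [proj, reflect, B_add_left, B_smul_left, h12, h23, h13, h21, h32, h31,
      h₁.1, h₂.1, h₃.1]
    ext i
    simp only [Pi.add_apply, Pi.smul_apply, smul_eq_mul]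
    ring

end A3

/-- For three roots forming a chain of type `A₃` (`B(δ₁,δ₂) = B(δ₂,δ₃) = 1`,
`B(δ₁,δ₃) = 0`), the subgroup generated by the three reflections has exactly 17 orbits
on the 72 roots. -/
theorem orbits_A3 (δ₁ δ₂ δ₃ : Fin 7 → ℤ) (h₁ : δ₁ ∈ R) (h₂ : δ₂ ∈ R) (h₃ : δ₃ ∈ R)
    (h12 : B δ₁ δ₂ = 1) (h23 : B δ₂ δ₃ = 1) (h13 : B δ₁ δ₃ = 0)
    (g₁ g₂ g₃ : Equiv.Perm (Fin 7 → ℤ))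
    (hg₁ : ∀ β, g₁ β = reflect δ₁ β) (hg₂ : ∀ β, g₂ β = reflect δ₂ β)
    (hg₃ : ∀ β, g₃ β = reflect δ₃ β) :
    {O : Set (Fin 7 → ℤ) | ∃ β ∈ R,
      O = MulAction.orbit
        (Subgroup.closure {g₁, g₂, g₃} : Subgroup (Equiv.Perm (Fin 7 → ℤ))) β}.ncard
      = 17 := by
  obtain ⟨b, hb, hr, hi⟩ := A3.Q₁ δ₂ (A3.mem_roots h₂) δ₁ h₁ δ₃ h₃ h12 h23 h13
  set G := Subgroup.closure {g₁, g₂, g₃} with hG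
  have m₁ : g₁ ∈ G := Subgroup.subset_closure (by simp)
  have m₂ : g₂ ∈ G := Subgroup.subset_closure (by simp)
  have m₃ : g₃ ∈ G := Subgroup.subset_closure (by simp)
  have inv : ∀ g ∈ G, ∀ x, A3.proj δ₁ δ₂ δ₃ (g x) = A3.proj δ₁ δ₂ δ₃ x := by
    intro g hg
    induction hg using Subgroup.closure_induction with
    | mem g hg =>
      intro x
      obtain ⟨p1, p2, p3⟩ := A3.proj_step h₁ h₂ h₃ h12 h23 h13 x
      simp only [Set.mem_insert_iff, Set.mem_singleton_iff] at hg
      rcases hg with rfl | rfl | rfl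
      · rw [hg₁, p1]
      · rw [hg₂, p2]
      · rw [hg₃, p3]
    | one => intro x; rfl
    | mul a b _ _ ha hb => intro x; rw [Equiv.Perm.mul_apply, ha, hb]
    | inv a _ ha =>
      intro x
      rw [← ha (a⁻¹ x)]
      simp
  have reach : ∀ x y, Relation.ReflTransGen (A3.Step δ₁ δ₂ δ₃) x y → y ∈ MulAction.orbit G x := by
    intro x y hxy
    induction hxy with
    | refl => exact MulAction.mem_orbit_self x
    | tail _ hs ih =>
      obtain ⟨g, rfl⟩ := ih
      rcases hs with rfl | rfl | rfl
      · exact ⟨⟨g₁, m₁⟩ * g, by rw [← hg₁]; rfl⟩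
      · exact ⟨⟨g₂, m₂⟩ * g, by rw [← hg₂]; rfl⟩
      · exact ⟨⟨g₃, m₃⟩ * g, by rw [← hg₃]; rfl⟩
  have hset : {O : Set (Fin 7 → ℤ) | ∃ β ∈ R, O = MulAction.orbit G β}
      = (fun i => MulAction.orbit G (b i)) '' Set.univ := by
    ext O
    simp only [Set.mem_ofPred_eq, Set.image_univ, Set.mem_range]
    constructor
    · rintro ⟨β, hβ, rfl⟩
      obtain ⟨i, h⟩ := hr β hβ
      exact ⟨i, MulAction.orbit_eq_iff.2 (reach _ _ h)⟩
    · rintro ⟨i, rfl⟩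
      exact ⟨b i, hb i, rfl⟩
  rw [hset, Set.ncard_image_of_injective]
  · simp [Set.ncard_univ]
  · intro i j hij
    obtain ⟨g, hg⟩ := MulAction.orbit_eq_iff.1 hij
    apply hi
    rw [← hg]
    exact inv g.1 g.2 _
end

section
/- The group of ℤ-linear automorphisms g of L satisfying B(g(x),g(y)) = B(x,y) for all x, y ∈ L and g(h) = h is finite of order 51840. (The automorphism group of the root lattice h^⊥ ≅ E6 induced from isometries of Pic(S) fixing the hyperplane class is the Weyl group W(E6), which is also the monodromy group of the universal family of smooth cubic surface hyperplane sections.) -/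
/-- isometries fixing `h` -/
def GG : Set ((Fin 7 → ℤ) ≃ₗ[ℤ] (Fin 7 → ℤ)) :=
  {g | (∀ x y, B (g x) (g y) = B x y) ∧ g h = h}

/-- the basis vectors -/
def ee (i : Fin 7) : Fin 7 → ℤ := Pi.single i 1

theorem B_expand (x y : Fin 7 → ℤ) : B x y = x 0 * y 0 - (x 1 * y 1 + x 2 * y 2 + x 3 * y 3
    + x 4 * y 4 + x 5 * y 5 + x 6 * y 6) := by
  simp only [B, Fin.sum_univ_six]
  rfl

theorem B_h (x : Fin 7 → ℤ) : B x h = 3 * x 0 + (x 1 + x 2 + x 3 + x 4 + x 5 + x 6) := by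
  rw [B_expand]
  simp [h]
  ring

theorem B_ee0 (x : Fin 7 → ℤ) : B x (ee 0) = x 0 := by
  rw [B_expand]; simp [ee]

theorem B_ees (x : Fin 7 → ℤ) (i : Fin 6) : B x (ee i.succ) = - x i.succ := by
  simp [B, ee, Pi.single_apply]

/-- `-B(·,α)` as a linear map -/
def Bl (α : Fin 7 → ℤ) : (Fin 7 → ℤ) →ₗ[ℤ] ℤ where
  toFun x := - B x α
  map_add' x y := by simp only [B_expand, Pi.add_apply]; ring
  map_smul' c x := by simp only [B_expand, Pi.smul_apply, smul_eq_mul, RingHom.id_apply]; ring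

theorem Bl_apply (α x : Fin 7 → ℤ) : Bl α x = - B x α := rfl

theorem refl_mem (α : Fin 7 → ℤ) (hα : Bl α α = 2) (h0 : B h α = 0) :
    Module.reflection hα ∈ GG := by
  constructor
  · intro x y
    have h2 : B α α = -2 := by rw [Bl_apply] at hα; linarith
    simp only [Module.reflection_apply, Bl_apply]
    have key : ∀ s t : ℤ, B (x - s • α) (y - t • α)
        = B x y - t * B x α - s * B y α + s * t * B α α := by
      intro s t
      simp only [B_expand, Pi.sub_apply, Pi.smul_apply, smul_eq_mul]; ring
    rw [key, h2]; ring
  · simp [Module.reflection_apply, Bl_apply, h0]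

theorem mul_mem {a b : (Fin 7 → ℤ) ≃ₗ[ℤ] (Fin 7 → ℤ)} (ha : a ∈ GG) (hb : b ∈ GG) :
    b.trans a ∈ GG := by
  refine ⟨fun x y => ?_, ?_⟩
  · simp [ha.1, hb.1]
  · simp [ha.2, hb.2]

theorem symm_mem {a : (Fin 7 → ℤ) ≃ₗ[ℤ] (Fin 7 → ℤ)} (ha : a ∈ GG) : a.symm ∈ GG := by
  refine ⟨fun x y => ?_, ?_⟩
  · rw [← ha.1]; simp
  · rw [LinearEquiv.symm_apply_eq, ha.2]

/-- coordinate permutations -/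
def PP (σ : Equiv.Perm (Fin 6)) : (Fin 7 → ℤ) ≃ₗ[ℤ] (Fin 7 → ℤ) where
  toFun x := Fin.cons (x 0) (fun i => x (σ i).succ)
  invFun x := Fin.cons (x 0) (fun i => x (σ.symm i).succ)
  map_add' x y := by ext j; refine Fin.cases ?_ (fun i => ?_) j <;> simp
  map_smul' c x := by ext j; refine Fin.cases ?_ (fun i => ?_) j <;> simp
  left_inv x := by ext j; refine Fin.cases ?_ (fun i => ?_) j <;> simp
  right_inv x := by ext j; refine Fin.cases ?_ (fun i => ?_) j <;> simp

theorem PP_zero (σ : Equiv.Perm (Fin 6)) (x : Fin 7 → ℤ) : PP σ x 0 = x 0 := rfl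
theorem PP_succ (σ : Equiv.Perm (Fin 6)) (x : Fin 7 → ℤ) (i : Fin 6) :
    PP σ x i.succ = x (σ i).succ := rfl

theorem PP_mem (σ : Equiv.Perm (Fin 6)) : PP σ ∈ GG := by
  refine ⟨fun x y => ?_, ?_⟩
  · simp only [B, PP_zero, PP_succ]
    rw [Equiv.sum_comp σ (fun i => x i.succ * y i.succ)]
  · ext j
    refine Fin.cases ?_ (fun i => ?_) j
    · rfl
    · rw [PP_succ]; simp [h]

theorem PP_ee0 (σ : Equiv.Perm (Fin 6)) : PP σ (ee 0) = ee 0 := by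
  ext j
  refine Fin.cases ?_ (fun i => ?_) j
  · rfl
  · rw [PP_succ]; simp [ee]

theorem PP_inj : Function.Injective PP := by
  intro σ τ hst
  ext1 i
  have := congrArg (fun g : (Fin 7 → ℤ) ≃ₗ[ℤ] (Fin 7 → ℤ) => g (ee (τ i).succ) i.succ) hst
  simp only [PP_succ, ee, Pi.single_apply] at this
  by_contra hne
  simp [hne] at this

theorem fix_ee0 {g : (Fin 7 → ℤ) ≃ₗ[ℤ] (Fin 7 → ℤ)} (hg : g ∈ GG) (h0 : g (ee 0) = ee 0) :
    ∃ σ, g = PP σ := by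
  have hz : ∀ x, g x 0 = x 0 := fun x => by
    rw [← B_ee0 (g x), ← B_ee0 x, ← hg.1 x, h0]
  have hex : ∀ i : Fin 6, ∃ j : Fin 6, g (ee i.succ) = ee j.succ := by
    intro i
    have a0 : g (ee i.succ) 0 = 0 := by rw [hz]; simp [ee]
    have a1 : B (g (ee i.succ)) (g (ee i.succ)) = -1 := by rw [hg.1, B_ees]; simp [ee]
    have a2 : B (g (ee i.succ)) h = 1 := by
      rw [← hg.2, hg.1]
      fin_cases i <;> simp [B_h, ee] <;> decide
    generalize g (ee i.succ) = v at a0 a1 a2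
    have b1 : ∑ i : Fin 6, v i.succ * v i.succ = 1 := by
      simp only [B, a0] at a1; linarith
    have b2 : ∑ i : Fin 6, v i.succ = 1 := by
      rw [B_h, a0] at a2
      rw [Fin.sum_univ_six]
      simpa using a2
    have : ∃ j : Fin 6, v j.succ ≠ 0 := by
      by_contra! hc
      simp [hc] at b2
    obtain ⟨j, hj⟩ := this
    refine ⟨j, ?_⟩
    rw [← Finset.add_sum_erase _ _ (Finset.mem_univ j)] at b1 b2
    have c1 : 1 ≤ v j.succ * v j.succ := by
      have := mul_self_pos.2 hj
      omega
    have c2 : ∑ i ∈ Finset.univ.erase j, v (Fin.succ i) * v i.succ = 0 :=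
      le_antisymm (by linarith) (Finset.sum_nonneg fun i _ => mul_self_nonneg _)
    rw [Finset.sum_eq_zero_iff_of_nonneg (fun i _ => mul_self_nonneg _)] at c2
    have c3 : ∀ k, k ≠ j → v k.succ = 0 := fun k hk => by
      simpa using c2 k (by simp [hk])
    rw [Finset.sum_eq_zero (fun k hk => c3 k (Finset.ne_of_mem_erase hk))] at b2
    ext k
    refine Fin.cases ?_ (fun k => ?_) k
    · simp [a0, ee]
    · by_cases hk : k = j
      · subst hk; simp [ee]; linarith
      · simp [ee, hk, c3 k hk]
  choose τ hτ using hex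
  have hinj : Function.Injective τ := by
    intro i j hij
    have : g (ee i.succ) = g (ee j.succ) := by rw [hτ, hτ, hij]
    have := congrFun (g.injective this) i.succ
    by_contra hne
    simp [ee, hne] at this
  let τ' := Equiv.ofBijective τ (Finite.injective_iff_bijective.1 hinj)
  refine ⟨τ'.symm, ?_⟩
  ext1 x
  ext j
  refine Fin.cases ?_ (fun j => ?_) j
  · rw [hz, PP_zero]
  · rw [PP_succ]
    obtain ⟨i, rfl⟩ := τ'.surjective j
    rw [Equiv.symm_apply_apply]
    have := hg.1 x (ee i.succ)
    rw [hτ, B_ees, B_ees] at this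
    change g x (τ i).succ = _
    linarith

/-- codes for the images of `e₀` -/
def Pc (c : Fin 6 → Fin 3) : Prop :=
  (3 + ∑ i, (c i).val) ^ 2 = 9 + 9 * ∑ i, (c i).val ^ 2

instance : DecidablePred Pc := fun c => by unfold Pc; infer_instance

theorem card_Pc : Fintype.card {c // Pc c} = 72 := by
  decide +kernel

/-- the vector attached to a code -/
def vec (c : Fin 6 → Fin 3) : Fin 7 → ℤ :=
  Fin.cons (1 + (((∑ i, (c i).val) / 3 : ℕ) : ℤ)) (fun i => - ((c i).val : ℤ))

theorem vec_inj : Function.Injective vec := by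
  intro c d hcd
  ext i
  have := congrFun hcd i.succ
  simpa [vec] using this

theorem vec_descent : ∀ c, Pc c → vec c 0 = 1 ∨ ∃ i j k : Fin 6, i < j ∧ j < k ∧
    vec c 0 + vec c i.succ + vec c j.succ + vec c k.succ < 0 := by
  decide +kernel

theorem vec_S : ∀ c, Pc c → B (vec c) (vec c) = 1 ∧ B (vec c) h = 3 := by
  decide +kernel

theorem code_exists (v : Fin 7 → ℤ) (h1 : B v v = 1) (h2 : B v h = 3) :
    ∃ c, Pc c ∧ vec c = v := by
  have s2 : ∑ i : Fin 6, v i.succ = 3 - 3 * v 0 := by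
    rw [B_h] at h2
    rw [Fin.sum_univ_six]
    change v 1 + v 2 + v 3 + v 4 + v 5 + v 6 = _
    linarith
  have s1 : ∑ i : Fin 6, v i.succ ^ 2 = v 0 ^ 2 - 1 := by
    simp only [B] at h1
    simp only [pow_two]
    linarith
  have bd : ∀ i : Fin 6, (3 - 3 * v 0 - v i.succ) ^ 2 ≤ 5 * (v 0 ^ 2 - 1 - v i.succ ^ 2) := by
    intro i
    have := sq_sum_le_card_mul_sum_sq (s := Finset.univ.erase i) (f := fun i : Fin 6 => v i.succ)
    rw [← Finset.add_sum_erase _ _ (Finset.mem_univ i)] at s1 s2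
    rw [Finset.card_erase_of_mem (Finset.mem_univ i)] at this
    have e1 : ∑ i ∈ Finset.univ.erase i, v (Fin.succ i) = 3 - 3 * v 0 - v i.succ := by linarith
    have e2 : ∑ i ∈ Finset.univ.erase i, v (Fin.succ i) ^ 2 = v 0 ^ 2 - 1 - v i.succ ^ 2 := by
      linarith
    rw [e1, e2] at this
    simpa using this
  have ha : 1 ≤ v 0 ∧ v 0 ≤ 5 := by
    have := bd 0
    generalize v (Fin.succ 0) = b at this
    constructor <;> nlinarith [sq_nonneg (2 * b + v 0 - 1), sq_nonneg (b - 1 + v 0)]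
  have hb : ∀ i : Fin 6, -2 ≤ v i.succ ∧ v i.succ ≤ 0 := by
    intro i
    have := bd i
    generalize v (Fin.succ i) = b at this
    obtain ⟨l, u⟩ := ha
    generalize v 0 = a at *
    interval_cases a <;> constructor <;> nlinarith
  let c : Fin 6 → Fin 3 := fun i => ⟨(- v i.succ).toNat, by have := hb i; omega⟩
  have hc : ∀ i, (((c i).val : ℕ) : ℤ) = - v i.succ := fun i => by
    have := hb i
    simp only [c]; omega
  have hs : ((∑ i, (c i).val : ℕ) : ℤ) = 3 * v 0 - 3 := by
    push_cast
    simp only [hc, Finset.sum_neg_distrib, s2]; ring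
  refine ⟨c, ?_, ?_⟩
  · unfold Pc
    zify
    push_cast at hs
    rw [hs]
    simp only [hc, neg_sq, s1]
    ring
  · ext j
    refine Fin.cases ?_ (fun j => ?_) j
    · simp only [vec, Fin.cons_zero]
      omega
    · simp only [vec, Fin.cons_succ, hc]; ring

theorem transitive (n : ℕ) : ∀ v : Fin 7 → ℤ, B v v = 1 → B v h = 3 → v 0 ≤ n →
    ∃ t ∈ GG, t (ee 0) = v := by
  induction n with
  | zero =>
    intro v h1 h2 h3
    obtain ⟨c, hc, rfl⟩ := code_exists v h1 h2
    simp only [vec, Fin.cons_zero] at h3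
    omega
  | succ n ih =>
    intro v h1 h2 h3
    obtain ⟨c, hc, hv⟩ := code_exists v h1 h2
    rcases vec_descent c hc with h4 | ⟨i, j, k, hij, hjk, hlt⟩
    · refine ⟨LinearEquiv.refl ℤ _, ⟨fun _ _ => rfl, rfl⟩, ?_⟩
      rw [hv] at h4
      have s : ∑ i : Fin 6, v i.succ * v i.succ = 0 := by
        simp only [B, h4] at h1; linarith
      rw [Finset.sum_eq_zero_iff_of_nonneg (fun i _ => mul_self_nonneg _)] at s
      ext m
      refine Fin.cases ?_ (fun m => ?_) m
      · simp [ee, h4]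
      · have := s m (Finset.mem_univ _)
        simp at this
        simp [ee, this]
    · rw [hv] at hlt
      let α : Fin 7 → ℤ := ee 0 - ee i.succ - ee j.succ - ee k.succ
      have hBα : ∀ x, B x α = x 0 + x i.succ + x j.succ + x k.succ := by
        intro x
        have : B x α = B x (ee 0) - B x (ee i.succ) - B x (ee j.succ) - B x (ee k.succ) := by
          simp only [α, B_expand, Pi.sub_apply]; ring
        rw [this, B_ee0, B_ees, B_ees, B_ees]; ring
      have n1 := hij.ne
      have n2 := hjk.ne
      have n3 := (hij.trans hjk).ne
      have hα : Bl α α = 2 := by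
        rw [Bl_apply, hBα]
        simp [α, ee, n1, n2, n3, n1.symm, n2.symm, n3.symm]
      have hα0 : α 0 = 1 := by simp [α, ee]
      have hr : Module.reflection hα ∈ GG := refl_mem α hα (by rw [hBα]; simp [h])
      obtain ⟨t, ht, hte⟩ := ih (Module.reflection hα v) (by rw [hr.1, h1])
        (by rw [← h2, ← hr.1 v h, hr.2]) (by
          rw [Module.reflection_apply, Bl_apply, hBα]
          simp only [Pi.sub_apply, Pi.smul_apply, hα0, smul_eq_mul]
          push_cast at h3
          linarith)
      refine ⟨t.trans (Module.reflection hα), mul_mem hr ht, ?_⟩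
      rw [LinearEquiv.trans_apply, hte, Module.involutive_reflection hα v]

theorem exists_t (c : {c // Pc c}) : ∃ t ∈ GG, t (ee 0) = vec c.1 :=
  transitive (vec c.1 0).toNat _ (vec_S _ c.2).1 (vec_S _ c.2).2 (Int.self_le_toNat _)

theorem GG_card : GG.Finite ∧ GG.ncard = 51840 := by
  choose t ht hte using exists_t
  let f : {c // Pc c} × Equiv.Perm (Fin 6) → ((Fin 7 → ℤ) ≃ₗ[ℤ] (Fin 7 → ℤ)) :=
    fun p => (PP p.2).trans (t p.1)
  have hinj : Function.Injective f := by
    rintro ⟨c, σ⟩ ⟨d, τ⟩ hcd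
    have hcd' : ∀ x, t c (PP σ x) = t d (PP τ x) := fun x =>
      congrArg (fun g : (Fin 7 → ℤ) ≃ₗ[ℤ] (Fin 7 → ℤ) => g x) hcd
    have h1 := hcd' (ee 0)
    rw [PP_ee0, PP_ee0, hte, hte] at h1
    have h2 : c = d := Subtype.ext (vec_inj h1)
    subst h2
    have h3 : σ = τ := PP_inj (LinearEquiv.ext fun x => (t c).injective (hcd' x))
    rw [h3]
  have hrange : GG = Set.range f := by
    ext g
    constructor
    · intro hg
      obtain ⟨c, hc, hv⟩ := code_exists (g (ee 0)) (by rw [hg.1, B_ee0]; rfl)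
        (by rw [← hg.2, hg.1, B_h]; decide)
      obtain ⟨σ, hσ⟩ := fix_ee0 (mul_mem (symm_mem (ht ⟨c, hc⟩)) hg) (by
        rw [LinearEquiv.trans_apply, LinearEquiv.symm_apply_eq, hte, hv])
      refine ⟨(⟨c, hc⟩, σ), ?_⟩
      ext1 x
      simp only [f, ← hσ, LinearEquiv.trans_apply, LinearEquiv.apply_symm_apply]
    · rintro ⟨p, rfl⟩
      exact mul_mem (ht _) (PP_mem _)
  rw [hrange]
  refine ⟨Set.finite_range f, ?_⟩
  rw [← Set.image_univ, Set.ncard_image_of_injective _ hinj, Set.ncard_univ,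
    Nat.card_eq_fintype_card, Fintype.card_prod, card_Pc, Fintype.card_perm, Fintype.card_fin]
  rfl

/-- The group of ℤ-linear automorphisms of the lattice preserving `B` and fixing `h`
(the Weyl group `W(E6)`) is finite of order 51840. -/
theorem isometries_fixing_h_card :
    {g : (Fin 7 → ℤ) ≃ₗ[ℤ] (Fin 7 → ℤ) |
      (∀ x y, B (g x) (g y) = B x y) ∧ g h = h}.Finite ∧
    {g : (Fin 7 → ℤ) ≃ₗ[ℤ] (Fin 7 → ℤ) |
      (∀ x y, B (g x) (g y) = B x y) ∧ g h = h}.ncard = 51840 := GG_card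
end
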